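/- Let X be a compact space with at least three points whose topology is the interval topology of a circular order R, and let a ≠ b be points of X. Then there exists a continuous function f : X → [0,1] with f(a) = 0, f(b) = 1, whose cyclic variation is at most 3. -/

import Mathlib

/-- A circular order on a set `X`: a ternary relation satisfying cyclicity,
asymmetry, transitivity and totality. -/
structure CircularOrderRel (X : Type*) where
  rel : X → X → X → Prop
  cyclic : ∀ a b c, rel a b c → rel b c a
  asymm : ∀ a b c, rel a b c → ¬ rel a c b
  trans : ∀ a b c d, rel a b c → rel a c d → rel a b d
  total : ∀ a b c : X, a ≠ b → b ≠ c → a ≠ c → rel a b c ∨ rel a c b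

/-- The interval topology of a ternary (circular order) relation: the topology
generated by the open intervals `(a,b) = {x | [a,x,b]}` for distinct `a, b`. -/
def intervalTopology {X : Type*} (r : X → X → X → Prop) : TopologicalSpace X :=
  TopologicalSpace.generateFrom {s | ∃ a b : X, a ≠ b ∧ s = {x | r a x b}}

/-- The closed interval `[a,c]` of a circular order relation. -/
def closedArc {X : Type*} (r : X → X → X → Prop) (a c : X) : Set X :=
  {a, c} ∪ {x | r a x c}

/-- A map between circularly ordered sets is c-order preserving (COP). -/
def IsCOP {X Y : Type*} (r : X → X → X → Prop) (r' : Y → Y → Y → Prop)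
    (f : X → Y) : Prop :=
  (∀ a b c : X, r a b c → f a ≠ f b → f b ≠ f c → f a ≠ f c → r' (f a) (f b) (f c)) ∧
  (∀ a c : X, f a = f c →
    (∀ x ∈ closedArc r a c, f x = f a) ∨ (∀ x ∈ closedArc r c a, f x = f a))

/-- A sequence of real valued functions is independent. -/
def IsIndepSeq {X : Type*} (f : ℕ → X → ℝ) : Prop :=
  ∃ a b : ℝ, a < b ∧ ∀ P M : Finset ℕ, Disjoint P M →
    ((⋂ n ∈ P, {x | f n x < a}) ∩ (⋂ n ∈ M, {x | b < f n x})).Nonempty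

/-- The standard circular order on `{0, 1, …, n-1}` (integers mod `n`). -/
def cyclicFin {n : ℕ} (i j k : Fin n) : Prop :=
  (i < j ∧ j < k) ∨ (j < k ∧ k < i) ∨ (k < i ∧ i < j)

/-- A tuple `(x 0, …, x (n-1))` is a cycle in a circularly ordered set. -/
def IsCycle {X : Type*} (r : X → X → X → Prop) {n : ℕ} (x : Fin n → X) : Prop :=
  (∀ i j k : Fin n, cyclicFin i j k → x i ≠ x j → x j ≠ x k → x i ≠ x k →
      r (x i) (x j) (x k)) ∧
  (∀ i k : Fin n, x i = x k →
    (∀ j : Fin n, (j = i ∨ j = k ∨ cyclicFin i j k) → x j = x i) ∨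
    (∀ j : Fin n, (j = i ∨ j = k ∨ cyclicFin k j i) → x j = x i))

/-- `f` has cyclic variation at most `v`. -/
def CyclicVariationLe {X : Type*} (r : X → X → X → Prop) (f : X → ℝ) (v : ℝ) : Prop :=
  ∀ (n : ℕ) (x : Fin (n + 1) → X), IsCycle r x →
    ∑ i : Fin (n + 1), |f (x i) - f (x (i + 1))| ≤ v

namespace CircularOrderRel

variable {X : Type*} (R : CircularOrderRel X)

theorem rel_left_ne {a b c : X} (h : R.rel a b c) : a ≠ b := by
  rintro rfl
  exact R.asymm _ _ _ h (R.cyclic _ _ _ (R.cyclic _ _ _ (R.cyclic _ _ _ (R.cyclic _ _ _ h))))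

theorem rel_right_ne {a b c : X} (h : R.rel a b c) : b ≠ c :=
  R.rel_left_ne (R.cyclic _ _ _ h)

theorem rel_outer_ne {a b c : X} (h : R.rel a b c) : a ≠ c :=
  (R.rel_right_ne (R.cyclic _ _ _ h)).symm

/-- The linear order with least element `a` obtained by cutting a circular order at `a`. -/
@[reducible]
noncomputable def cutOrder (a : X) : LinearOrder X where
  le x y := x = a ∨ x = y ∨ R.rel a x y
  le_refl x := Or.inr (Or.inl rfl)
  le_trans x y z := by
    rintro (rfl | rfl | hxy) (rfl | rfl | hyz)
    all_goals first
      | tauto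
      | exact absurd rfl (R.rel_outer_ne hxy)
      | exact Or.inr (Or.inr (R.trans _ _ _ _ hxy hyz))
  le_antisymm x y := by
    rintro (rfl | rfl | hxy) (rfl | h | hyx)
    all_goals first
      | rfl
      | exact h.symm
      | exact absurd rfl (R.rel_outer_ne ‹_›)
      | exact absurd hyx (R.asymm _ _ _ hxy)
  le_total x y := by
    by_cases hx : x = a
    · exact Or.inl (Or.inl hx)
    by_cases hy : y = a
    · exact Or.inr (Or.inl hy)
    by_cases hxy : x = y
    · exact Or.inl (Or.inr (Or.inl hxy))
    rcases R.total a x y (Ne.symm hx) hxy (Ne.symm hy) with h | h <;> tauto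
  toDecidableLE := Classical.decRel _

theorem cutOrder_le_iff {a x y : X} :
    (R.cutOrder a).le x y ↔ x = a ∨ x = y ∨ R.rel a x y := Iff.rfl

theorem cutOrder_lt_iff {a x y : X} :
    (R.cutOrder a).lt x y ↔ (x = a ∧ y ≠ a) ∨ R.rel a x y := by
  let _ := R.cutOrder a
  change x < y ↔ _
  rw [lt_iff_le_and_ne]
  change (x = a ∨ x = y ∨ R.rel a x y) ∧ x ≠ y ↔ _
  constructor
  · rintro ⟨rfl | rfl | h, hne⟩
    · exact Or.inl ⟨rfl, hne.symm⟩
    · exact absurd rfl hne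
    · exact Or.inr h
  · rintro (⟨rfl, h⟩ | h)
    · exact ⟨Or.inl rfl, h.symm⟩
    · exact ⟨Or.inr (Or.inr h), R.rel_right_ne h⟩

/-- A circular order is recovered from each of its cuts. -/
theorem rel_of_cutOrder_lt_lt {a x y z : X} (hxy : (R.cutOrder a).lt x y)
    (hyz : (R.cutOrder a).lt y z) : R.rel x y z := by
  rw [cutOrder_lt_iff] at hxy hyz
  rcases hxy with ⟨rfl, hy⟩ | hxy
  · exact hyz.resolve_left fun h => hy h.1
  · rcases hyz with ⟨rfl, -⟩ | hyz
    · exact absurd rfl (R.rel_outer_ne hxy)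
    · have h1 := R.cyclic _ _ _ hyz
      have h2 := R.cyclic _ _ _ (R.cyclic _ _ _ hxy)
      exact R.cyclic _ _ _ (R.cyclic _ _ _ (R.trans _ _ _ _ h1 h2))

theorem cutOrder_lt_of_rel {a x y z : X} (h : R.rel x y z) (hyx : (R.cutOrder a).lt y x) :
    (R.cutOrder a).lt z x := by
  let _ := R.cutOrder a
  by_contra hzx
  have hxz : x < z := lt_of_le_of_ne (not_lt.mp hzx) (R.rel_outer_ne h)
  exact R.asymm _ _ _ (R.cyclic _ _ _ (R.rel_of_cutOrder_lt_lt hyx hxz))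
    (R.cyclic _ _ _ (R.cyclic _ _ _ (R.cyclic _ _ _ h)))

theorem not_mem_closedArc_iff {u v : X} (huv : u ≠ v) {x : X} :
    x ∉ closedArc R.rel u v ↔ R.rel v x u := by
  simp only [closedArc, Set.mem_union, Set.mem_insert_iff, Set.mem_singleton_iff,
    Set.mem_ofPred_eq, not_or]
  constructor
  · rintro ⟨⟨hu, hv⟩, h⟩
    have := (R.total u x v (Ne.symm hu) hv huv).resolve_left h
    exact R.cyclic _ _ _ this
  · intro h
    exact ⟨⟨R.rel_right_ne h, (R.rel_left_ne h).symm⟩,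
      R.asymm _ _ _ (R.cyclic _ _ _ (R.cyclic _ _ _ h))⟩

end CircularOrderRel

theorem cyclicFin_add_one {n : ℕ} {i j : Fin (n + 1)} (hij : i ≠ j) (hj : i + 1 ≠ j) :
    cyclicFin i (i + 1) j := by
  have h := Fin.val_add_one i
  simp only [cyclicFin, Fin.lt_def, ne_eq, Fin.ext_iff, Fin.val_last] at *
  split_ifs at h <;> omega

/-- In a linearly ordered space, `a < b` are separated by a continuous monotone function. -/
theorem exists_continuous_monotone_of_lt {α : Type*} [LinearOrder α] [TopologicalSpace α]
    [OrderTopology α] {a b : α} (hab : a < b) :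
    ∃ g : α → ℝ, Monotone g ∧ Continuous g ∧ (∀ x, g x ∈ Set.Icc (0 : ℝ) 1) ∧
      g a = 0 ∧ g b = 1 := by
  by_cases hjump : ∃ c d, a ≤ c ∧ c ⋖ d ∧ d ≤ b
  · obtain ⟨c, d, hac, hcd, hdb⟩ := hjump
    have hclopen : IsClopen (Set.Ici d) := ⟨isClosed_Ici, hcd.Ioi_eq ▸ isOpen_Ioi⟩
    refine ⟨(Set.Ici d).indicator fun _ => 1, ?_, ?_, ?_, ?_, ?_⟩
    · intro x y hxy
      by_cases hx : d ≤ x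
      · simp [Set.indicator, hx, hx.trans hxy]
      · simp only [Set.indicator, Set.mem_Ici, hx, if_false]
        split_ifs <;> simp
    · exact continuous_const.indicator fun x hx => by simp [hclopen.frontier_eq] at hx
    · intro x
      by_cases hx : d ≤ x <;> simp [Set.indicator, hx]
    · simp [Set.indicator, (hac.trans_lt hcd.lt).not_ge]
    · simp [Set.indicator, hdb]
  · have hdense : ∀ c d, a ≤ c → c < d → d ≤ b → ∃ e, c < e ∧ e < d := by
      intro c d hac hcd hdb
      by_contra h
      push Not at h
      exact hjump ⟨c, d, hac, ⟨hcd, fun e hce hed => (h e hce).not_gt hed⟩, hdb⟩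
    have : DenselyOrdered (Set.Ioo a b) := ⟨fun x y hxy => by
      obtain ⟨e, hxe, hey⟩ := hdense x y x.2.1.le hxy y.2.2.le
      exact ⟨⟨e, x.2.1.trans hxe, hey.trans y.2.2⟩, hxe, hey⟩⟩
    have : Nontrivial (Set.Ioo a b) := by
      obtain ⟨e, hae, heb⟩ := hdense a b le_rfl hab le_rfl
      obtain ⟨e', hae', hee'⟩ := hdense a e le_rfl hae heb.le
      exact ⟨⟨e, hae, heb⟩, ⟨e', hae', hee'.trans heb⟩, fun h => hee'.ne' (congrArg (·.1) h)⟩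
    obtain ⟨S, hS, hSd, -, hStop⟩ := exists_countable_dense_bot_top unitInterval
    have := hS.to_subtype
    obtain ⟨e⟩ := Order.embedding_from_countable_to_dense S (Set.Ioo a b)
    let g : α → unitInterval := fun x => sSup {t | ∃ h : t ∈ S, (e ⟨t, h⟩ : α) ≤ x}
    have hg : Monotone g := fun x y hxy =>
      sSup_le_sSup fun t ⟨h, ht⟩ => ⟨h, ht.trans hxy⟩
    have hge : ∀ t : S, g (e t) = t := by
      intro t
      apply le_antisymm
      · refine sSup_le fun s ⟨h, hs⟩ => ?_
        exact (e.le_iff_le (a := ⟨s, h⟩) (b := t)).mp hs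
      · exact le_sSup ⟨t.2, le_rfl⟩
    have hgc : Continuous g :=
      hg.continuous_of_denseRange (hSd.mono fun t ht => ⟨_, hge ⟨t, ht⟩⟩)
    refine ⟨fun x => g x, fun x y hxy => hg hxy, continuous_subtype_val.comp hgc,
      fun x => (g x).2, ?_, ?_⟩
    · have : g a = 0 := by
        apply le_antisymm _ unitInterval.nonneg'
        refine sSup_le fun s ⟨h, hs⟩ => ?_
        exact absurd hs (e ⟨s, h⟩).2.1.not_ge
      simp [this]
    · have : g b = 1 := le_antisymm unitInterval.le_one'
        (le_sSup ⟨hStop 1 fun _ => unitInterval.le_one', (e _).2.2.le⟩)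
      simp [this]

namespace CircularOrderRel

variable {X : Type*} (R : CircularOrderRel X)

theorem isOpen_rel [tX : TopologicalSpace X] (htop : tX = intervalTopology R.rel) {u v : X}
    (huv : u ≠ v) : IsOpen {x | R.rel u x v} := by
  subst htop
  exact TopologicalSpace.isOpen_generateFrom_of_mem ⟨u, v, huv, rfl⟩

theorem isClosed_closedArc [tX : TopologicalSpace X] (htop : tX = intervalTopology R.rel)
    (hthree : ∃ x y z : X, x ≠ y ∧ y ≠ z ∧ x ≠ z) (u v : X) :
    IsClosed (closedArc R.rel u v) := by
  by_cases huv : u = v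
  · subst huv
    have harc : closedArc R.rel u u = {u} := by
      ext x
      have : ¬ R.rel u x u := fun h => R.rel_outer_ne h rfl
      simp [closedArc, this]
    rw [harc, ← isOpen_compl_iff, isOpen_iff_forall_mem_open]
    intro p hp
    obtain ⟨q, hqu, hqp⟩ : ∃ q, q ≠ u ∧ q ≠ p := by
      obtain ⟨x, y, z, hxy, hyz, hxz⟩ := hthree
      by_contra! h
      by_cases hx : x = u
      · subst hx
        exact hyz ((h y hxy.symm).trans (h z hxz.symm).symm)
      · by_cases hy : y = u
        · subst hy
          exact hxz ((h x hxy).trans (h z hyz.symm).symm)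
        · exact hxy ((h x hx).trans (h y hy).symm)
    rcases R.total u p q (Ne.symm hp) hqp.symm hqu.symm with h | h
    · exact ⟨_, fun x hx => (R.rel_left_ne hx).symm, R.isOpen_rel htop hqu.symm, h⟩
    · exact ⟨_, fun x hx => R.rel_right_ne hx, R.isOpen_rel htop hqu, R.cyclic _ _ _ h⟩
  · rw [← isOpen_compl_iff]
    convert R.isOpen_rel htop (Ne.symm huv) using 1
    ext x
    exact R.not_mem_closedArc_iff huv

theorem exists_continuousOn_closedArc [tX : TopologicalSpace X]
    (htop : tX = intervalTopology R.rel) (hthree : ∃ x y z : X, x ≠ y ∧ y ≠ z ∧ x ≠ z)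
    {a b : X} (hab : a ≠ b) :
    ∃ g : X → ℝ, ContinuousOn g (closedArc R.rel a b) ∧ (∀ x, g x ∈ Set.Icc (0 : ℝ) 1) ∧
      g a = 0 ∧ g b = 1 ∧ ∀ x y, R.rel a x y → g x ≤ g y := by
  let ord := R.cutOrder a
  have hle {x y : X} : x ≤ y ↔ x = a ∨ x = y ∨ R.rel a x y := Iff.rfl
  have harc {x v : X} : x ∈ closedArc R.rel a v ↔ x ≤ v := by
    simp [closedArc, hle, or_assoc]
  have harc' {x v : X} (hv : v ≠ a) (hvb : v ≤ b) (hx : x ≤ b) :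
      x ∈ closedArc R.rel v b ↔ v ≤ x := by
    constructor
    · rintro ((rfl | rfl) | h)
      · exact le_rfl
      · exact hvb
      · by_contra hxv
        exact (R.cutOrder_lt_of_rel h (not_le.mp hxv)).not_ge hvb
    · intro hvx
      rcases hvx.eq_or_lt with rfl | hvx
      · exact Or.inl (Or.inl rfl)
      rcases hx.eq_or_lt with rfl | hx
      · exact Or.inl (Or.inr rfl)
      · exact Or.inr (R.rel_of_cutOrder_lt_lt hvx hx)
  have hlt : a < b := R.cutOrder_lt_iff.mpr (Or.inl ⟨rfl, hab.symm⟩)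
  obtain ⟨g, hmono, hcont, hIcc, ha, hb⟩ :=
    @exists_continuous_monotone_of_lt X ord (Preorder.topology X)
      (@OrderTopology.mk X (Preorder.topology X) _ rfl) a b hlt
  refine ⟨g, ?_, hIcc, ha, hb, fun x y h => hmono (Or.inr (Or.inr h))⟩
  have hincl : @Continuous (closedArc R.rel a b) X _ (Preorder.topology X) Subtype.val := by
    refine continuous_generateFrom_iff.mpr ?_
    rintro s ⟨v, rfl | rfl⟩
    · convert ((R.isClosed_closedArc htop hthree a v).preimage
        (continuous_subtype_val (p := (· ∈ closedArc R.rel a b)))).isOpen_compl using 1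
      ext x
      simp [harc]
    · by_cases hvb : v ≤ b
      · by_cases hva : v = a
        · convert isOpen_empty using 1
          ext x
          have : v ≤ x := Or.inl hva
          simpa using this
        · convert ((R.isClosed_closedArc htop hthree v b).preimage
            (continuous_subtype_val (p := (· ∈ closedArc R.rel a b)))).isOpen_compl using 1
          ext x
          simp [harc' hva hvb (harc.mp x.2)]
      · convert isOpen_univ using 1
        ext x
        simpa using (harc.mp x.2).trans_lt (not_le.mp hvb)
  rw [continuousOn_iff_continuous_domRestrict]
  exact @Continuous.comp _ _ _ _ (Preorder.topology X) _ _ _ hcont hincl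

theorem eq_of_cutOrder_lt_of_isCycle {a : X} {n : ℕ} {x : Fin (n + 1) → X}
    (hx : IsCycle R.rel x) {i j : Fin (n + 1)} (hi : (R.cutOrder a).lt (x (i + 1)) (x i))
    (hj : (R.cutOrder a).lt (x (j + 1)) (x j)) : i = j := by
  let _ := R.cutOrder a
  have key : ∀ i j : Fin (n + 1), x (i + 1) < x i → x i ≠ x j → x j < x i := by
    intro i j hi hij
    by_cases h : x (i + 1) = x j
    · exact h ▸ hi
    · have hc : cyclicFin i (i + 1) j :=
        cyclicFin_add_one (fun e => hij (congrArg x e)) fun e => h (congrArg x e)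
      exact R.cutOrder_lt_of_rel (hx.1 _ _ _ hc hi.ne' h hij) hi
  by_contra hne
  by_cases hij : x i = x j
  · rcases hx.2 i j hij with h | h
    · refine hi.ne (h (i + 1) ?_)
      by_cases e : i + 1 = j
      · exact Or.inr (Or.inl e)
      · exact Or.inr (Or.inr (cyclicFin_add_one hne e))
    · refine hj.ne ((h (j + 1) ?_).trans hij)
      by_cases e : j + 1 = i
      · exact Or.inl e
      · exact Or.inr (Or.inr (cyclicFin_add_one (Ne.symm hne) e))
  · exact (key i j hi hij).asymm (key j i hj (Ne.symm hij))

/-- A function dominated, along a cut, by the increments of a function with values in `[0, 2]`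
has cyclic variation at most `3` if its values lie in `[0, 1]`. -/
theorem cyclicVariationLe_three {a : X} {f K : X → ℝ} (hf : ∀ x, f x ∈ Set.Icc (0 : ℝ) 1)
    (hK : ∀ x, K x ∈ Set.Icc (0 : ℝ) 2)
    (hfK : ∀ x y, (R.cutOrder a).le x y → |f x - f y| ≤ K y - K x) :
    CyclicVariationLe R.rel f 3 := by
  classical
  intro n x hx
  let _ := R.cutOrder a
  have hterm : ∀ i : Fin (n + 1), |f (x i) - f (x (i + 1))| ≤
      (K (x (i + 1)) - K (x i)) + if x (i + 1) < x i then 3 else 0 := by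
    intro i
    split_ifs with h
    · have h1 := hf (x i)
      have h2 := hf (x (i + 1))
      have h3 := hK (x i)
      have h4 := hK (x (i + 1))
      rw [Set.mem_Icc] at *
      rw [abs_le]
      constructor <;> linarith
    · simpa using hfK _ _ (not_lt.mp h)
  have hcyc : ∑ i : Fin (n + 1), K (x (i + 1)) = ∑ i, K (x i) :=
    Equiv.sum_comp (Equiv.addRight (1 : Fin (n + 1))) fun i => K (x i)
  have hcard : (Finset.univ.filter fun i : Fin (n + 1) => x (i + 1) < x i).card ≤ 1 := by
    refine Finset.card_le_one.mpr fun i hi j hj => ?_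
    exact R.eq_of_cutOrder_lt_of_isCycle hx (Finset.mem_filter.mp hi).2
      (Finset.mem_filter.mp hj).2
  have hcard' : ((Finset.univ.filter fun i : Fin (n + 1) => x (i + 1) < x i).card : ℝ) ≤ 1 := by
    exact_mod_cast hcard
  calc _ ≤ _ := Finset.sum_le_sum fun i _ => hterm i
    _ = (Finset.univ.filter fun i : Fin (n + 1) => x (i + 1) < x i).card * 3 := by
      rw [Finset.sum_add_distrib, Finset.sum_sub_distrib, hcyc, sub_self, zero_add,
        ← Finset.sum_filter, Finset.sum_const, nsmul_eq_mul]
    _ ≤ 3 := by linarith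

end CircularOrderRel

/-- On a compact circularly ordered space with at least three
points, any two distinct points `a ≠ b` are separated by a continuous
function `f : X → [0,1]` with `f a = 0`, `f b = 1` and cyclic variation
at most `3`. -/
theorem separating_function_of_bounded_cyclic_variation
    {X : Type*} [tX : TopologicalSpace X] [CompactSpace X]
    (R : CircularOrderRel X)
    (htop : tX = intervalTopology R.rel)
    (hthree : ∃ x y z : X, x ≠ y ∧ y ≠ z ∧ x ≠ z)
    (a b : X) (hab : a ≠ b) :
    ∃ f : X → ℝ, Continuous f ∧ (∀ x : X, f x ∈ Set.Icc (0 : ℝ) 1) ∧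
      f a = 0 ∧ f b = 1 ∧ CyclicVariationLe R.rel f 3 := by
  classical
  obtain ⟨g, hg, hgI, hga, hgb, hgm⟩ := R.exists_continuousOn_closedArc htop hthree hab
  obtain ⟨h, hh, hhI, hhb, hha, hhm⟩ := R.exists_continuousOn_closedArc htop hthree hab.symm
  let f : X → ℝ := fun x => if x ∈ closedArc R.rel a b then g x else 1 - h x
  let K : X → ℝ := fun x => if x ∈ closedArc R.rel a b then g x else 1 + h x
  have ha : a ∈ closedArc R.rel a b := Or.inl (Or.inl rfl)
  have hb : b ∈ closedArc R.rel a b := Or.inl (Or.inr rfl)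
  have hfarc : Set.EqOn f (fun x => 1 - h x) (closedArc R.rel b a) := by
    rintro x ((rfl | rfl) | hx)
    · simp [f, hb, hgb, hhb]
    · simp [f, ha, hga, hha]
    · simp [f, (R.not_mem_closedArc_iff hab).mpr hx]
  have hfI : ∀ x, f x ∈ Set.Icc (0 : ℝ) 1 := by
    intro x
    simp only [f]
    split_ifs
    · exact hgI x
    · exact ⟨sub_nonneg.mpr (hhI x).2, sub_le_self _ (hhI x).1⟩
  refine ⟨f, ?_, hfI, by simp [f, ha, hga], by simp [f, hb, hgb],
    R.cyclicVariationLe_three (a := a) (K := K) hfI ?_ ?_⟩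
  · have huniv : closedArc R.rel a b ∪ closedArc R.rel b a = Set.univ := by
      refine Set.eq_univ_of_forall fun x => or_iff_not_imp_left.mpr fun hx => ?_
      exact Or.inr ((R.not_mem_closedArc_iff hab).mp hx)
    rw [← continuousOn_univ, ← huniv]
    exact (hg.congr fun x hx => if_pos hx).union_of_isClosed
      ((continuousOn_const.sub hh).congr hfarc)
      (R.isClosed_closedArc htop hthree a b) (R.isClosed_closedArc htop hthree b a)
  · intro x
    simp only [K]
    split_ifs
    · exact ⟨(hgI x).1, (hgI x).2.trans one_le_two⟩
    · exact ⟨by linarith [(hhI x).1], by linarith [(hhI x).2]⟩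
  · intro x y hxy
    rw [R.cutOrder_le_iff] at hxy
    simp only [f, K]
    split_ifs with hx hy hy
    · have hle : g x ≤ g y := by
        rcases hxy with rfl | rfl | hxy
        · exact hga ▸ (hgI y).1
        · exact le_rfl
        · exact hgm x y hxy
      rw [abs_of_nonpos (sub_nonpos.mpr hle), neg_sub]
    · rw [abs_le]
      constructor <;> linarith [(hgI x).2, (hhI y).1]
    · refine absurd ?_ hx
      rcases hxy with rfl | rfl | hxy
      · exact ha
      · exact hy
      · rcases hy with (rfl | rfl) | hy
        · exact absurd rfl (R.rel_outer_ne hxy)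
        · exact Or.inr hxy
        · exact Or.inr (R.trans _ _ _ _ hxy hy)
    · have hle : h x ≤ h y := by
        rcases hxy with rfl | rfl | hxy
        · exact absurd ha hx
        · exact le_rfl
        · have hxab := R.cyclic _ _ _ ((R.not_mem_closedArc_iff hab).mp hx)
          have hxyb := R.trans _ _ _ _ (R.cyclic _ _ _ hxy) hxab
          exact hhm x y (R.cyclic _ _ _ (R.cyclic _ _ _ hxyb))
      rw [abs_le]
      constructor <;> linarith
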